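/- Let (W,S) be a finite Coxeter system with longest element w0. For I ⊆ J ⊆ S, the descent class 𝒟_I^J = {w ∈ W : I ⊆ D_R(w) ⊆ J} is equal to the interval [w0(I), w0·w0(J^c)] of the left weak order, where J^c = S \ J. -/

import Mathlib

open Polynomial

namespace CoxeterCharPoly

variable {B W : Type*} [Group W] {M : CoxeterMatrix B}

/-- The left weak order on a Coxeter group. -/
def wle (cs : CoxeterSystem M W) (u w : W) : Prop :=
  cs.length w = cs.length (w * u⁻¹) + cs.length u

/-- The standard parabolic subgroup generated by `J ⊆ S`. -/
def parabolic (cs : CoxeterSystem M W) (J : Set B) : Subgroup W :=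
  Subgroup.closure (cs.simple '' J)

/- The longest element of the parabolic subgroup `W_J` (junk value if there is
no element of maximal length). -/
open Classical in
noncomputable def w0 (cs : CoxeterSystem M W) (J : Set B) : W :=
  if h : ∃ w ∈ parabolic cs J, ∀ u ∈ parabolic cs J, cs.length u ≤ cs.length w
  then h.choose else 1

/-- The right descent set of `w`, as a subset of `B`. -/
def rightDescents (cs : CoxeterSystem M W) (w : W) : Set B :=
  {i | cs.IsRightDescent w i}

/- `μ` is the Möbius function of the subposet `A` of the order `le`. -/
open Classical in
def IsMobiusOn {α : Type*} (le : α → α → Prop) (A : Set α) (μ : α → α → ℤ) : Prop :=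
  ∀ a ∈ A, ∀ b ∈ A, le a b →
    (∑ᶠ t ∈ {t | t ∈ A ∧ le a t ∧ le t b}, μ a t) = if a = b then 1 else 0

open Classical in
/-- The involution `(t, ε) ↦ (a t a⁻¹, ε + [t = a])` used to build the reflection
representation of a Coxeter group on signed elements. -/
noncomputable def signedConj (a : W) : Function.End (W × ZMod 2) :=
  fun p ↦ (a * p.1 * a⁻¹, p.2 + if p.1 = a then 1 else 0)

open Classical in
theorem signedConj_mul_pow_apply {a b : W} (ha : a * a = 1) (hb : b * b = 1) (k : ℕ)
    (t : W) (ε : ZMod 2) :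
    ((signedConj a * signedConj b) ^ k) (t, ε) =
      ((a * b) ^ k * t * ((a * b) ^ k)⁻¹,
        ε + ∑ l ∈ Finset.range (2 * k), if t = (b * a) ^ l * b then 1 else 0) := by
  have ha' : a⁻¹ = a := inv_eq_of_mul_eq_one_left ha
  have hb' : b⁻¹ = b := inv_eq_of_mul_eq_one_left hb
  induction k with
  | zero => simp [Function.End.one_def]
  | succ k ih =>
    have hinv : ((a * b) ^ k)⁻¹ = (b * a) ^ k := by
      rw [← inv_pow, mul_inv_rev, ha', hb']
    have hsemi : b * (a * b) ^ k = (b * a) ^ k * b := by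
      have h : SemiconjBy b (a * b) (b * a) := by simp [SemiconjBy, mul_assoc]
      exact (h.pow_right k).eq
    have h1 : (a * b) ^ k * t * ((a * b) ^ k)⁻¹ = b ↔ t = (b * a) ^ (2 * k) * b := by
      rw [mul_inv_eq_iff_eq_mul, hsemi, ← eq_inv_mul_iff_mul_eq, hinv, two_mul, pow_add,
        mul_assoc]
    have h2 : b * ((a * b) ^ k * t * ((a * b) ^ k)⁻¹) * b⁻¹ = a ↔
        t = (b * a) ^ (2 * k + 1) * b := by
      rw [mul_inv_eq_iff_eq_mul, ← eq_inv_mul_iff_mul_eq, mul_inv_eq_iff_eq_mul,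
        ← eq_inv_mul_iff_mul_eq, hinv, hb']
      have : (b * a) ^ k * (b * (a * b) * (a * b) ^ k) = (b * a) ^ (2 * k + 1) * b := by
        calc (b * a) ^ k * (b * (a * b) * (a * b) ^ k)
            = (b * a) ^ k * (b * a) * (b * (a * b) ^ k) := by simp only [mul_assoc]
          _ = (b * a) ^ (2 * k + 1) * b := by
            rw [hsemi, ← pow_succ, ← mul_assoc, ← pow_add]
            congr 2
            omega
      rw [this]
    rw [pow_succ']
    change signedConj a (signedConj b (((signedConj a * signedConj b) ^ k) (t, ε))) = _
    rw [ih]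
    simp only [signedConj, h1, h2]
    rw [show 2 * (k + 1) = 2 * k + 1 + 1 by ring, Finset.sum_range_succ, Finset.sum_range_succ]
    refine Prod.ext ?_ ?_
    · simp only [pow_succ' (a * b) k, mul_inv_rev, mul_assoc]
    · simp only [add_assoc]

theorem isLiftable_signedConj (cs : CoxeterSystem M W) :
    M.IsLiftable fun i ↦ signedConj (cs.simple i) := by
  classical
  intro i j
  funext ⟨t, ε⟩
  rw [signedConj_mul_pow_apply (cs.simple_mul_simple_self i) (cs.simple_mul_simple_self j),
    cs.simple_mul_simple_pow, two_mul, Finset.sum_range_add]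
  simp only [pow_add, cs.simple_mul_simple_pow', one_mul, CharTwo.add_self_eq_zero]
  simp [Function.End.one_def]

open Classical in
/-- The parity of the number of occurrences of `t` in the right inversion sequence of a word
depends only on the product of the word. -/
theorem lift_signedConj_wordProd (cs : CoxeterSystem M W) (ω : List B) (t : W) (ε : ZMod 2) :
    cs.lift ⟨_, isLiftable_signedConj cs⟩ (cs.wordProd ω) (t, ε) =
      (cs.wordProd ω * t * (cs.wordProd ω)⁻¹, ε + (cs.rightInvSeq ω).count t) := by
  induction ω with
  | nil => simp [Function.End.one_def]
  | cons i ω ih =>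
    have h : cs.wordProd ω * t * (cs.wordProd ω)⁻¹ = cs.simple i ↔
        (cs.wordProd ω)⁻¹ * cs.simple i * cs.wordProd ω = t := by
      rw [mul_inv_eq_iff_eq_mul, ← eq_inv_mul_iff_mul_eq, eq_comm, mul_assoc]
    rw [cs.wordProd_cons, map_mul, cs.lift_apply_simple]
    change signedConj _ (cs.lift ⟨_, isLiftable_signedConj cs⟩ (cs.wordProd ω) (t, ε)) = _
    rw [ih]
    simp only [signedConj, h, CoxeterSystem.rightInvSeq, List.count_cons, beq_iff_eq]
    refine Prod.ext ?_ ?_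
    · simp only [mul_inv_rev, mul_assoc]
    · push_cast
      rw [add_assoc]

/-- The exchange property. -/
theorem exists_eraseIdx_of_isRightDescent (cs : CoxeterSystem M W) (ω : List B) (i : B)
    (h : cs.IsRightDescent (cs.wordProd ω) i) :
    ∃ j < ω.length, cs.wordProd ω * cs.simple i = cs.wordProd (ω.eraseIdx j) := by
  classical
  obtain ⟨ω', hω', hprod⟩ := cs.exists_isReduced (cs.wordProd ω * cs.simple i)
  have hw : cs.wordProd (ω'.concat i) = cs.wordProd ω := by
    rw [cs.wordProd_concat, ← hprod, cs.simple_mul_simple_cancel_right]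
  have hred : cs.IsReduced (ω'.concat i) := by
    have h1 := cs.isRightDescent_iff.mp h
    have h2 := hω'.eq
    rw [← hprod] at h2
    rw [CoxeterSystem.IsReduced, hw, List.length_concat]
    omega
  have hmem' : cs.simple i ∈ cs.rightInvSeq (ω'.concat i) := by
    rw [cs.rightInvSeq_concat]
    simp
  have hcount : (cs.rightInvSeq (ω'.concat i)).count (cs.simple i) = 1 :=
    List.count_eq_one_of_mem hred.nodup_rightInvSeq hmem'
  have key := lift_signedConj_wordProd cs (ω'.concat i) (cs.simple i) 0
  rw [hw, lift_signedConj_wordProd, hcount] at key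
  have hne : ((cs.rightInvSeq ω).count (cs.simple i) : ZMod 2) = 1 := by
    simpa using congrArg Prod.snd key
  have hmem : cs.simple i ∈ cs.rightInvSeq ω := by
    by_contra hnot
    rw [List.count_eq_zero_of_not_mem hnot] at hne
    simp at hne
  obtain ⟨j, hj, hget⟩ := List.mem_iff_getElem.mp hmem
  refine ⟨j, by simpa using hj, ?_⟩
  rw [← cs.wordProd_mul_getD_rightInvSeq, List.getD_eq_getElem _ _ hj, hget]

theorem wordProd_mem_parabolic (cs : CoxeterSystem M W) {I : Set B} {ω : List B}
    (h : ∀ i ∈ ω, i ∈ I) : cs.wordProd ω ∈ parabolic cs I := by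
  refine Subgroup.list_prod_mem _ fun x hx ↦ ?_
  obtain ⟨i, hi, rfl⟩ := List.mem_map.mp hx
  exact Subgroup.subset_closure ⟨i, h i hi, rfl⟩

theorem exists_word_of_mem_parabolic (cs : CoxeterSystem M W) {I : Set B} {v : W}
    (hv : v ∈ parabolic cs I) : ∃ ω : List B, (∀ i ∈ ω, i ∈ I) ∧ cs.wordProd ω = v := by
  induction hv using Subgroup.closure_induction with
  | mem x hx =>
    obtain ⟨i, hi, rfl⟩ := hx
    exact ⟨[i], by simpa using hi, by simp⟩
  | one => exact ⟨[], by simp, by simp⟩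
  | mul x y _ _ hx hy =>
    obtain ⟨ω, hω, rfl⟩ := hx
    obtain ⟨ω', hω', rfl⟩ := hy
    refine ⟨ω ++ ω', fun i hi ↦ ?_, cs.wordProd_append _ _⟩
    exact (List.mem_append.mp hi).elim (hω i) (hω' i)
  | inv x _ hx =>
    obtain ⟨ω, hω, rfl⟩ := hx
    exact ⟨ω.reverse, fun i hi ↦ hω i (List.mem_reverse.mp hi), cs.wordProd_reverse ω⟩

/-- If all of `I` consists of right descents of `w`, then a word in `I` that is shortest among the
words in `I` with the same product can be split off on the right of `w`. -/
theorem length_mul_inv_add_le (cs : CoxeterSystem M W) {I : Set B} {w : W}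
    (hw : I ⊆ rightDescents cs w) (ω : List B) (hω : ∀ i ∈ ω, i ∈ I)
    (hmin : ∀ ω' : List B, (∀ i ∈ ω', i ∈ I) → cs.wordProd ω' = cs.wordProd ω →
      ω.length ≤ ω'.length) :
    cs.length (w * (cs.wordProd ω)⁻¹) + ω.length ≤ cs.length w := by
  induction ω using List.reverseRecOn with
  | nil => simp
  | append_singleton ω i ih =>
    have hωI : ∀ k ∈ ω, k ∈ I := fun k hk ↦ hω k (List.mem_append_left _ hk)
    have hi : i ∈ I := hω i (by simp)
    have ih := ih hωI fun ω' h' hp ↦ by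
      have := hmin (ω' ++ [i])
        (fun k hk ↦ (List.mem_append.mp hk).elim (h' k) fun hk ↦ by simp_all)
        (by rw [cs.wordProd_append, cs.wordProd_append, hp])
      simpa using this
    obtain ⟨α, hα, hαw⟩ := cs.exists_isReduced (w * (cs.wordProd ω)⁻¹)
    have hword : cs.wordProd (α ++ ω) = w := by
      rw [cs.wordProd_append, ← hαw, inv_mul_cancel_right]
    have hdesc : cs.IsRightDescent (cs.wordProd (α ++ ω)) i := by
      rw [hword]
      exact hw hi
    obtain ⟨j, hj, hex⟩ := exists_eraseIdx_of_isRightDescent cs _ i hdesc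
    have hαl := hα.eq
    rw [← hαw] at hαl
    rw [cs.wordProd_append, cs.wordProd_singleton, List.length_append, List.length_singleton]
    by_cases hjα : j < α.length
    · rw [List.eraseIdx_append_of_lt_length hjα, hword, cs.wordProd_append] at hex
      have hval : w * (cs.wordProd ω * cs.simple i)⁻¹ = cs.wordProd (α.eraseIdx j) := by
        rw [mul_inv_rev, cs.inv_simple, ← mul_assoc, hex, mul_inv_cancel_right]
      have hle := cs.length_wordProd_le (α.eraseIdx j)
      rw [List.length_eraseIdx_of_lt hjα] at hle
      rw [hval]
      omega
    · push Not at hjα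
      rw [List.length_append] at hj
      rw [List.eraseIdx_append_of_length_le hjα, cs.wordProd_append, cs.wordProd_append,
        mul_assoc, mul_right_inj] at hex
      have hlt : j - α.length < ω.length := by omega
      have := hmin (ω.eraseIdx (j - α.length))
        (fun k hk ↦ hωI k (List.mem_of_mem_eraseIdx hk))
        (by rw [← hex, cs.wordProd_append, cs.wordProd_singleton])
      rw [List.length_eraseIdx_of_lt hlt, List.length_append, List.length_singleton] at this
      omega

/-- If all of `I` consists of right descents of `w`, then every element of `W_I` lies below `w`
in the left weak order. -/
theorem wle_of_mem_parabolic (cs : CoxeterSystem M W) {I : Set B} {w v : W}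
    (hw : I ⊆ rightDescents cs w) (hv : v ∈ parabolic cs I) : wle cs v w := by
  obtain ⟨ω, ⟨hω, rfl⟩, hmin⟩ :=
    WellFounded.has_min (measure (List.length (α := B))).wf
      {ω : List B | (∀ i ∈ ω, i ∈ I) ∧ cs.wordProd ω = v} (exists_word_of_mem_parabolic cs hv)
  have h1 := length_mul_inv_add_le cs hw ω hω fun ω' h' hp ↦ not_lt.mp (hmin ω' ⟨h', hp⟩)
  have h2 := cs.length_mul_le (w * (cs.wordProd ω)⁻¹) (cs.wordProd ω)
  have h3 := cs.length_wordProd_le ω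
  rw [inv_mul_cancel_right] at h2
  unfold wle
  omega

theorem w0_spec (cs : CoxeterSystem M W) [Finite W] (J : Set B) :
    w0 cs J ∈ parabolic cs J ∧ ∀ u ∈ parabolic cs J, cs.length u ≤ cs.length (w0 cs J) := by
  have h : ∃ w ∈ parabolic cs J, ∀ u ∈ parabolic cs J, cs.length u ≤ cs.length w :=
    Set.exists_max_image _ cs.length (Set.toFinite _) ⟨1, (parabolic cs J).one_mem⟩
  rw [w0, dif_pos h]
  exact h.choose_spec

theorem subset_rightDescents_w0 (cs : CoxeterSystem M W) [Finite W] (J : Set B) :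
    J ⊆ rightDescents cs (w0 cs J) := by
  intro i hi
  obtain ⟨hmem, hmax⟩ := w0_spec cs J
  have hle := hmax _ (mul_mem hmem (Subgroup.subset_closure ⟨i, hi, rfl⟩))
  exact lt_of_le_of_ne hle (cs.length_mul_simple_ne _ i)

theorem rightDescents_subset_of_wle (cs : CoxeterSystem M W) {u w : W} (h : wle cs u w) :
    rightDescents cs u ⊆ rightDescents cs w := by
  intro i hi
  have h1 := cs.length_mul_le (w * u⁻¹) (u * cs.simple i)
  rw [← mul_assoc, inv_mul_cancel_right] at h1
  change cs.length (u * cs.simple i) < cs.length u at hi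
  change cs.length (w * cs.simple i) < cs.length w
  unfold wle at h
  omega

theorem subset_rightDescents_iff_wle (cs : CoxeterSystem M W) [Finite W] (I : Set B) (w : W) :
    I ⊆ rightDescents cs w ↔ wle cs (w0 cs I) w :=
  ⟨fun h ↦ wle_of_mem_parabolic cs h (w0_spec cs I).1,
    fun h ↦ (subset_rightDescents_w0 cs I).trans (rightDescents_subset_of_wle cs h)⟩

theorem length_w0_univ_mul_add (cs : CoxeterSystem M W) [Finite W] (w : W) :
    cs.length (w0 cs Set.univ * w) + cs.length w = cs.length (w0 cs Set.univ) := by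
  have hmem : w⁻¹ ∈ parabolic cs Set.univ := by
    rw [parabolic, Set.image_univ, cs.subgroup_closure_range_simple]
    trivial
  have h := wle_of_mem_parabolic cs (subset_rightDescents_w0 cs Set.univ) hmem
  rw [wle, inv_inv, cs.length_inv] at h
  exact h.symm

theorem rightDescents_w0_univ_mul (cs : CoxeterSystem M W) [Finite W] (w : W) :
    rightDescents cs (w0 cs Set.univ * w) = (rightDescents cs w)ᶜ := by
  ext i
  have h1 := length_w0_univ_mul_add cs w
  have h2 := length_w0_univ_mul_add cs (w * cs.simple i)
  have h3 := cs.length_mul_simple_ne w i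
  simp only [rightDescents, CoxeterSystem.IsRightDescent, Set.mem_ofPred_eq, Set.mem_compl_iff,
    mul_assoc]
  omega

theorem wle_w0_univ_mul_iff (cs : CoxeterSystem M W) [Finite W] (u w : W) :
    wle cs u (w0 cs Set.univ * w) ↔ wle cs w (w0 cs Set.univ * u) := by
  have h1 := length_w0_univ_mul_add cs w
  have h2 := length_w0_univ_mul_add cs u
  have h3 := length_w0_univ_mul_add cs (w * u⁻¹)
  have h4 := length_w0_univ_mul_add cs (u * w⁻¹)
  have h5 : cs.length (u * w⁻¹) = cs.length (w * u⁻¹) := by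
    rw [← cs.length_inv, mul_inv_rev, inv_inv]
  simp only [wle, mul_assoc]
  omega

/-- in a finite Coxeter group, the descent class
`𝒟_I^J = {w : I ⊆ D_R(w) ⊆ J}` equals the weak-order interval
`[w0(I), w0 · w0(Jᶜ)]`. -/
theorem descentClass_eq_interval (cs : CoxeterSystem M W) [Finite W]
    (I J : Set B) (hIJ : I ⊆ J) :
    {w : W | I ⊆ rightDescents cs w ∧ rightDescents cs w ⊆ J} =
      {w : W | wle cs (w0 cs I) w ∧ wle cs w (w0 cs Set.univ * w0 cs Jᶜ)} := by
  ext w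
  rw [Set.mem_ofPred_eq, Set.mem_ofPred_eq, subset_rightDescents_iff_wle cs I,
    ← wle_w0_univ_mul_iff, ← subset_rightDescents_iff_wle cs Jᶜ, rightDescents_w0_univ_mul,
    Set.compl_subset_compl]

end CoxeterCharPoly
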